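/- Let 0 < ε ≤ 1/4 and let d be a positive natural number. Let P be the d-fold product measure of the Bernoulli(1/2) distribution on {0,1} and let Q be the d-fold product measure of the Bernoulli(1/2+ε) distribution on {0,1}. Then for every measurable set A ⊆ {0,1}^d, |P(A) − Q(A)| ≤ ε·√(2d). -/

import Mathlib

open MeasureTheory

/-- The Bernoulli(p) measure on `Bool`: mass `p` at `true` and `1 - p` at `false`. -/
noncomputable def bernoulliMeasure (p : ℝ) : Measure Bool :=
  ENNReal.ofReal p • Measure.dirac true + ENNReal.ofReal (1 - p) • Measure.dirac false

lemma bern_singleton (p : ℝ) (h0 : 0 ≤ p) (h1 : p ≤ 1) (b : Bool) :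
    (bernoulliMeasure p {b}).toReal = if b then p else 1 - p := by
  cases b <;> simp [bernoulliMeasure, h0, h1]

instance bern_finite (p : ℝ) : IsFiniteMeasure (bernoulliMeasure p) := by
  constructor
  simp [bernoulliMeasure]

lemma pi_bern_apply (p : ℝ) (h0 : 0 ≤ p) (h1 : p ≤ 1) (d : ℕ) (s : Finset (Fin d → Bool)) :
    ((Measure.pi fun _ : Fin d => bernoulliMeasure p) s).toReal =
      ∑ x ∈ s, ∏ i, (if x i then p else 1 - p) := by
  have h := sum_measureReal_singleton (μ := Measure.pi fun _ : Fin d => bernoulliMeasure p) s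
  rw [← measureReal_def, ← h]
  refine Finset.sum_congr rfl fun x _ => ?_
  rw [measureReal_def, Measure.pi_singleton, ENNReal.toReal_prod]
  exact Finset.prod_congr rfl fun i _ => bern_singleton p h0 h1 _

lemma two_point (a a' b b' c : ℝ) (ha : 0 ≤ a) (ha' : 0 ≤ a') (hb : 0 ≤ b) (hb' : 0 ≤ b')
    (h1 : a + a' = 1) (h2 : b + b' = 1) (hc : 0 ≤ c)
    (h : c ≤ √a * √b + √a' * √b') : (a - b) ^ 2 ≤ 1 - c ^ 2 := by
  have e1 := Real.sq_sqrt ha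
  have e2 := Real.sq_sqrt ha'
  have e3 := Real.sq_sqrt hb
  have e4 := Real.sq_sqrt hb'
  generalize √a = x at *
  generalize √a' = y at *
  generalize √b = z at *
  generalize √b' = w at *
  have hx : x ^ 2 + y ^ 2 = 1 := by linarith
  have hz : z ^ 2 + w ^ 2 = 1 := by linarith
  have hc2 : c ^ 2 ≤ (x * z + y * w) ^ 2 := by gcongr
  have k1 : (x * z + y * w) ^ 2 + (x * w - y * z) ^ 2 = 1 := by
    have : (x * z + y * w) ^ 2 + (x * w - y * z) ^ 2 = (x ^ 2 + y ^ 2) * (z ^ 2 + w ^ 2) := by ring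
    rw [this, hx, hz]; norm_num
  have k2 : (x * z - y * w) ^ 2 + (x * w + y * z) ^ 2 = 1 := by
    have : (x * z - y * w) ^ 2 + (x * w + y * z) ^ 2 = (x ^ 2 + y ^ 2) * (z ^ 2 + w ^ 2) := by ring
    rw [this, hx, hz]; norm_num
  have k3 : a - b = (x * w - y * z) * (x * w + y * z) := by
    have : a - b = a * (b + b') - b * (a + a') := by rw [h1, h2]; ring
    rw [this, ← e1, ← e2, ← e3, ← e4]; ring
  have k4 : (x * w + y * z) ^ 2 ≤ 1 := by nlinarith [sq_nonneg (x * z - y * w)]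
  rw [k3, mul_pow]
  nlinarith [mul_le_mul_of_nonneg_left k4 (sq_nonneg (x * w - y * z))]

/-- For `0 < ε ≤ 1/4` and `d ≥ 1`, if `P` and `Q` are the `d`-fold products of
Bernoulli(1/2) and Bernoulli(1/2+ε) respectively, then for every measurable set
`A ⊆ {0,1}^d` we have `|P(A) − Q(A)| ≤ ε·√(2d)` (Pinsker's inequality combined with the
KL bound `D_KL(P‖Q) ≤ 4ε²d`). -/
theorem tv_pi_bernoulli_le (ε : ℝ) (hε : 0 < ε) (hε' : ε ≤ 1 / 4)
    (d : ℕ) (hd : 0 < d) (A : Set (Fin d → Bool)) (hA : MeasurableSet A) :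
    |((Measure.pi fun _ : Fin d => bernoulliMeasure (1 / 2)) A).toReal -
        ((Measure.pi fun _ : Fin d => bernoulliMeasure (1 / 2 + ε)) A).toReal| ≤
      ε * Real.sqrt (2 * d) := by
  classical
  obtain ⟨s, rfl⟩ : ∃ s : Finset (Fin d → Bool), (s : Set (Fin d → Bool)) = A :=
    ⟨A.toFinset, by simp⟩
  rw [pi_bern_apply _ (by norm_num) (by norm_num), pi_bern_apply _ (by linarith) (by linarith)]
  set m : ℝ → Bool → ℝ := fun p b => if b then p else 1 - p with hm
  have m0 : ∀ p b, 0 ≤ p → p ≤ 1 → 0 ≤ m p b := by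
    intro p b h0 h1
    cases b <;> simp [hm, h0, h1]
  have f0 : ∀ p, 0 ≤ p → p ≤ 1 → ∀ x : Fin d → Bool, 0 ≤ ∏ i, m p (x i) :=
    fun p h0 h1 x => Finset.prod_nonneg fun i _ => m0 p _ h0 h1
  have tot : ∀ p, ∑ x ∈ s, ∏ i, m p (x i) + ∑ x ∈ sᶜ, ∏ i, m p (x i) = 1 := by
    intro p
    rw [Finset.sum_add_sum_compl, ← Fintype.sum_pow]
    simp [hm]
  have p0 : (0:ℝ) ≤ 1 / 2 := by norm_num
  have p1 : (1 / 2 : ℝ) ≤ 1 := by norm_num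
  have q0 : (0:ℝ) ≤ 1 / 2 + ε := by linarith
  have q1 : (1 / 2 + ε : ℝ) ≤ 1 := by linarith
  have cs := fun t : Finset (Fin d → Bool) =>
    Real.sum_sqrt_mul_sqrt_le t (f0 _ p0 p1) (f0 _ q0 q1)
  set β : ℝ := ∑ b, √(m (1/2) b) * √(m (1/2+ε) b) with hβ
  have hβ0 : 0 ≤ β := Finset.sum_nonneg fun _ _ => by positivity
  have hβ2 : 1 - 2 * ε ^ 2 ≤ β ^ 2 := by
    have e : β = √(1/2) * √(1/2+ε) + √(1/2) * √(1/2-ε) := by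
      rw [hβ, Fintype.sum_bool]
      simp only [hm]
      norm_num
      congr 1; ring
    have s1 : √(1/2:ℝ) ^ 2 = 1/2 := Real.sq_sqrt p0
    have s2 : √(1/2+ε) ^ 2 = 1/2+ε := Real.sq_sqrt q0
    have s3 : √(1/2-ε) ^ 2 = 1/2-ε := Real.sq_sqrt (by linarith)
    have s4 : 1/2 - 2 * ε^2 ≤ √(1/2+ε) * √(1/2-ε) := by
      rw [← Real.sqrt_mul q0]
      apply Real.le_sqrt_of_sq_le
      nlinarith [sq_nonneg ε, mul_pos hε hε, pow_le_pow_left₀ hε.le hε' 2]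
    have : β ^ 2 = √(1/2:ℝ) ^ 2 * (√(1/2+ε) ^ 2 + √(1/2-ε) ^ 2 + 2 * (√(1/2+ε) * √(1/2-ε))) := by
      rw [e]; ring
    rw [this, s1, s2, s3]
    linarith
  have hβd : β ^ d = ∑ x : Fin d → Bool, √(∏ i, m (1/2) (x i)) * √(∏ i, m (1/2+ε) (x i)) := by
    rw [hβ, Fintype.sum_pow]
    refine Finset.sum_congr rfl fun x _ => ?_
    rw [Finset.prod_mul_distrib, Real.sqrt_prod _ fun i _ => m0 _ _ p0 p1,
      Real.sqrt_prod _ fun i _ => m0 _ _ q0 q1]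
  have key := two_point _ _ _ _ (β ^ d) (Finset.sum_nonneg fun x _ => f0 _ p0 p1 x)
    (Finset.sum_nonneg fun x _ => f0 _ p0 p1 x) (Finset.sum_nonneg fun x _ => f0 _ q0 q1 x)
    (Finset.sum_nonneg fun x _ => f0 _ q0 q1 x) (tot (1/2)) (tot (1/2+ε)) (by positivity)
    (by rw [hβd, ← Finset.sum_add_sum_compl s]; exact add_le_add (cs s) (cs sᶜ))
  have bern : 1 - 2 * d * ε ^ 2 ≤ (β ^ d) ^ 2 := by
    have h1 := one_add_mul_le_pow (a := -(2 * ε ^ 2)) (by nlinarith) d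
    have h2 : (1 + -(2 * ε ^ 2)) ^ d ≤ (β ^ 2) ^ d :=
      pow_le_pow_left₀ (by nlinarith) (by linarith) d
    rw [← pow_mul, mul_comm d 2, pow_mul]
    linarith
  apply abs_le_of_sq_le_sq _ (by positivity)
  rw [mul_pow, Real.sq_sqrt (by positivity)]
  refine le_trans key ?_
  linarith
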